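/- Let i : Y → X be a closed embedding of topological spaces. Given a retractive space (Z, s, r) over Y, let i_*Z denote the pushout of i : Y → X and s : Y → Z, with co-projections k : X → i_*Z and l : Z → i_*Z; i_*Z is a retractive space over X with section k and with retraction q : i_*Z → X the map induced on the pushout by id_X : X → X and i ∘ r : Z → X. Then for any two retractive spaces (Z, s, r) and (Z', s', r') over Y, the assignment sending a morphism of retractive spaces h : Z → Z' over Y to the induced morphism i_*h : i_*Z → i_*Z' over X (the map induced on pushouts by id_X and h) is a bijection from the set of morphisms of retractive spaces Z → Z' over Y to the set of morphisms of retractive spaces i_*Z → i_*Z' over X. -/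

import Mathlib

open Topology

universe u

/-- A commutative square of topological spaces
`f : A → Y`, `j : A → X`, `J : Y → Z`, `F : X → Z`
is a pushout square if it commutes and satisfies the universal property of the
pushout in the category of topological spaces. -/
def IsPushoutSquare {A Y X Z : Type u} [TopologicalSpace A] [TopologicalSpace Y]
    [TopologicalSpace X] [TopologicalSpace Z]
    (f : C(A, Y)) (j : C(A, X)) (J : C(Y, Z)) (F : C(X, Z)) : Prop :=
  (∀ a, J (f a) = F (j a)) ∧
  ∀ (T : Type u) [TopologicalSpace T] (u : C(X, T)) (v : C(Y, T)),
    (∀ a, u (j a) = v (f a)) →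
    ∃! w : C(Z, T), (∀ x, w (F x) = u x) ∧ (∀ y, w (J y) = v y)

theorem IsPushoutSquare.desc_fun {A Y X Z : Type u} [TopologicalSpace A] [TopologicalSpace Y]
    [TopologicalSpace X] [TopologicalSpace Z]
    {f : C(A, Y)} {j : C(A, X)} {J : C(Y, Z)} {F : C(X, Z)} (h : IsPushoutSquare f j J F)
    (T : Type u) (u : X → T) (v : Y → T) (huv : ∀ a, u (j a) = v (f a)) :
    ∃! w : Z → T, (∀ x, w (F x) = u x) ∧ (∀ y, w (J y) = v y) := by
  letI : TopologicalSpace T := ⊤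
  obtain ⟨w, hw, hu⟩ := h.2 T ⟨u, continuous_top⟩ ⟨v, continuous_top⟩ huv
  refine ⟨w, hw, fun w' hw' => ?_⟩
  have := hu ⟨w', continuous_top⟩ hw'
  exact congrArg (fun g : C(Z, T) => (g : Z → T)) this

theorem IsPushoutSquare.jointly_surj {A Y X Z : Type u} [TopologicalSpace A] [TopologicalSpace Y]
    [TopologicalSpace X] [TopologicalSpace Z]
    {f : C(A, Y)} {j : C(A, X)} {J : C(Y, Z)} {F : C(X, Z)} (h : IsPushoutSquare f j J F)
    (z : Z) : (∃ x, F x = z) ∨ (∃ y, J y = z) := by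
  have H := h.desc_fun (ULift.{u} Prop) (fun _ => ⟨True⟩) (fun _ => ⟨True⟩) (fun _ => rfl)
  have e := H.unique (y₁ := fun _ => ⟨True⟩)
    (y₂ := fun z => ⟨(∃ x, F x = z) ∨ (∃ y, J y = z)⟩) ⟨fun _ => rfl, fun _ => rfl⟩
    ⟨fun x => by simp, fun y => by simp⟩
  have e2 := congrArg ULift.down (congrFun e z)
  exact e2.mp trivial

theorem IsPushoutSquare.inj {A Y X Z : Type u} [TopologicalSpace A] [TopologicalSpace Y]
    [TopologicalSpace X] [TopologicalSpace Z]
    {f : C(A, Y)} {j : C(A, X)} {J : C(Y, Z)} {F : C(X, Z)} (h : IsPushoutSquare f j J F)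
    (hj : Function.Injective j) : Function.Injective J := by
  intro a b hab
  obtain ⟨w, ⟨-, hw⟩, -⟩ := h.desc_fun (ULift.{u} Prop) (fun x => ⟨∃ y, j y = x ∧ f y = a⟩)
    (fun z => ⟨z = a⟩) (fun c => by
      congr 1
      apply propext
      constructor
      · rintro ⟨y, hy, rfl⟩
        rw [hj hy]
      · intro hc
        exact ⟨c, rfl, hc⟩)
  have e : (⟨a = a⟩ : ULift.{u} Prop) = ⟨b = a⟩ := by rw [← hw a, ← hw b, hab]
  have e2 := congrArg ULift.down e
  exact (e2.mp rfl).symm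

theorem IsPushoutSquare.isInducing {A Y X Z : Type u} [TopologicalSpace A] [TopologicalSpace Y]
    [TopologicalSpace X] [TopologicalSpace Z]
    {f : C(A, Y)} {j : C(A, X)} {J : C(Y, Z)} {F : C(X, Z)} (h : IsPushoutSquare f j J F)
    (hj : IsInducing j) : IsInducing J := by
  refine ⟨le_antisymm J.continuous.le_induced ?_⟩
  intro U hU
  obtain ⟨V, hV, hVU⟩ := hj.isOpen_iff.mp (hU.preimage f.continuous)
  obtain ⟨w, ⟨-, hw⟩, -⟩ := h.2 (ULift.{u} Prop)
    ⟨fun x => ⟨x ∈ V⟩, continuous_uliftUp.comp (continuous_Prop.mpr hV)⟩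
    ⟨fun x => ⟨x ∈ U⟩, continuous_uliftUp.comp (continuous_Prop.mpr hU)⟩
    (fun a => by
      have : (a ∈ j ⁻¹' V) = (a ∈ f ⁻¹' U) := by rw [hVU]
      exact congrArg ULift.up this)
  refine ⟨{z | (w z).down}, continuous_Prop.mp (continuous_uliftDown.comp w.continuous), ?_⟩
  ext y
  simp [hw y]

/-- For a closed embedding `i : Y → X`, the pushout functor `i_*` from retractive
spaces over `Y` to retractive spaces over `X` is fully faithful: for retractive spaces
`(Z, s, r)` and `(Z', s', r')` over `Y`, with `i_*Z` the pushout of `i` and `s` (with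
co-projections `k : X → i_*Z`, `l : Z → i_*Z`, and retraction `q : i_*Z → X` induced
by `id_X` and `i ∘ r`), and similarly for `Z'`, the assignment sending a morphism
`h : Z → Z'` of retractive spaces over `Y` to the induced morphism
`i_*h : i_*Z → i_*Z'` of retractive spaces over `X` (characterized by
`i_*h ∘ k = k'` and `i_*h ∘ l = l' ∘ h`) is a bijection on morphism sets. -/
theorem pushout_functor_fully_faithful
    {Y X Z Z' PZ PZ' : Type u} [TopologicalSpace Y] [TopologicalSpace X]
    [TopologicalSpace Z] [TopologicalSpace Z'] [TopologicalSpace PZ]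
    [TopologicalSpace PZ']
    (i : C(Y, X)) (hi : IsClosedEmbedding i)
    -- the retractive space (Z, s, r) over Y
    (s : C(Y, Z)) (r : C(Z, Y)) (hr : ∀ y, r (s y) = y)
    -- the retractive space (Z', s', r') over Y
    (s' : C(Y, Z')) (r' : C(Z', Y)) (hr' : ∀ y, r' (s' y) = y)
    -- i_*Z : the pushout of i and s, with its section k and retraction q
    (k : C(X, PZ)) (l : C(Z, PZ)) (hP : IsPushoutSquare s i l k)
    (q : C(PZ, X)) (hqk : ∀ x, q (k x) = x) (hql : ∀ z, q (l z) = i (r z))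
    -- i_*Z' : the pushout of i and s', with its section k' and retraction q'
    (k' : C(X, PZ')) (l' : C(Z', PZ')) (hP' : IsPushoutSquare s' i l' k')
    (q' : C(PZ', X)) (hqk' : ∀ x, q' (k' x) = x) (hql' : ∀ z, q' (l' z) = i (r' z)) :
    ∃ Φ : {h : C(Z, Z') // (∀ y, h (s y) = s' y) ∧ ∀ z, r' (h z) = r z} →
          {G : C(PZ, PZ') // (∀ x, G (k x) = k' x) ∧ ∀ w, q' (G w) = q w},
      (∀ h, (∀ x, (Φ h).1 (k x) = k' x) ∧ ∀ z, (Φ h).1 (l z) = l' (h.1 z)) ∧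
      Function.Bijective Φ := by
  have hl'inj := hP'.inj hi.injective
  have hl'ind := hP'.isInducing hi.isInducing
  have key : ∀ h : {h : C(Z, Z') // (∀ y, h (s y) = s' y) ∧ ∀ z, r' (h z) = r z},
      ∃ G : {G : C(PZ, PZ') // (∀ x, G (k x) = k' x) ∧ ∀ w, q' (G w) = q w},
        (∀ x, G.1 (k x) = k' x) ∧ ∀ z, G.1 (l z) = l' (h.1 z) := by
    rintro ⟨h, hs, hrr⟩
    obtain ⟨w, ⟨hw1, hw2⟩, -⟩ := hP.2 PZ' k' (l'.comp h) (fun a => by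
      simp [hs, hP'.1])
    refine ⟨⟨w, hw1, fun p => ?_⟩, hw1, hw2⟩
    rcases hP.jointly_surj p with ⟨x, rfl⟩ | ⟨z, rfl⟩
    · rw [hw1, hqk, hqk']
    · rw [hw2, hql, ContinuousMap.comp_apply, hql', hrr]
  choose Φ hΦ using key
  refine ⟨Φ, hΦ, ?_, ?_⟩
  · intro h₁ h₂ e
    apply Subtype.ext
    ext z
    apply hl'inj
    rw [← (hΦ h₁).2, ← (hΦ h₂).2, e]
  · rintro ⟨G, hG1, hG2⟩
    have ex : ∀ z, ∃ z', l' z' = G (l z) := by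
      intro z
      rcases hP'.jointly_surj (G (l z)) with ⟨x, hx⟩ | h
      · have hx2 : x = i (r z) := by rw [← hqk' x, hx, hG2, hql]
        exact ⟨s' (r z), by rw [hP'.1, ← hx2, hx]⟩
      · exact h
    choose h hh using ex
    have hc : Continuous h := by
      rw [hl'ind.continuous_iff]
      have : l' ∘ h = G ∘ l := funext hh
      rw [this]
      exact G.continuous.comp l.continuous
    refine ⟨⟨⟨h, hc⟩, fun y => ?_, fun z => ?_⟩, ?_⟩
    · apply hl'inj
      change l' (h (s y)) = l' (s' y)
      rw [hh, hP.1, hG1, hP'.1]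
    · apply hi.injective
      change i (r' (h z)) = i (r z)
      rw [← hql', hh, hG2, hql]
    · apply Subtype.ext
      ext p
      rcases hP.jointly_surj p with ⟨x, rfl⟩ | ⟨z, rfl⟩
      · rw [(hΦ _).1, hG1]
      · rw [(hΦ _).2]
        exact hh z
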